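/- arXiv:1311.1579 — 2 statements merged into one kernel-verified Lean document; each statement's English description precedes it below -/
import Mathlib

section
/- For every integer n ≥ 9 there exist positive real numbers x2, x12 and a real number x13 with 1 + 50/(63n²) < x13 < 1 + 3/n² such that f1 = 0, f2 = 0 and f3 = 0. -/
/-- `f1` from the Einstein equations for the Stiefel manifold `V₄ℝⁿ = SO(n)/SO(n-4)`
(with the normalization `x23 = 1`). -/
def f1 (n x2 x12 x13 : ℝ) : ℝ :=
  -(n - 4) * x12 ^ 3 * x2 + (n - 4) * x12 ^ 2 * x13 * x2 ^ 2 + (n - 4) * x12 * x13 ^ 2 * x2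
    - 2 * (n - 2) * x12 * x13 * x2 + (n - 4) * x12 * x2 + x12 ^ 2 * x13 + 3 * x13 * x2 ^ 2

/-- `f2` from the Einstein equations for `V₄ℝⁿ`. -/
def f2 (n x2 x12 x13 : ℝ) : ℝ :=
  (n - 3) * x12 ^ 3 - 2 * (n - 2) * x12 ^ 2 * x13 - (n - 5) * x12 * x13 ^ 2
    + 2 * (n - 2) * x12 * x13 + (3 - n) * x12 + 2 * x12 ^ 2 * x13 * x2 - 2 * x13 * x2

/-- `f3` from the Einstein equations for `V₄ℝⁿ`. -/
def f3 (n x2 x12 x13 : ℝ) : ℝ :=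
  (n - 2) * x12 * x13 - (n - 2) * x12 + x12 ^ 2 - x12 * x13 * x2 - 2 * x13 ^ 2 + 2

/-! In the variables `h = 1 / n`, `x12 = h * σ`, `x13 = 1 + c * h ^ 2`, the elimination of `x2`
from `f2 = f3 = 0` leaves a quadratic equation `eliminant h σ c = 0` for `c`; substituting the value of
`x2` given by `f2 = 0` turns `f1 = 0` into `reduced h σ c = 0`. -/

/-- The leading coefficient of `eliminant h σ c` as a polynomial in `c`. -/
def elimLead (h σ : ℝ) : ℝ := h ^ 2 * (4 - h * σ ^ 2 + h ^ 2 * σ ^ 2)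

/-- The linear coefficient of `eliminant h σ c` as a polynomial in `c`. -/
def elimLin (h σ : ℝ) : ℝ :=
  h ^ 2 * σ ^ 2 * (6 - 2 * σ + 4 * h * σ) + 2 * (1 - h ^ 2 * σ ^ 2) * (4 + 2 * h * σ - σ)

/-- The constant coefficient of `eliminant h σ c` as a polynomial in `c`. -/
def elimConst (h σ : ℝ) : ℝ :=
  σ ^ 2 * (2 - 2 * σ + h * (4 * σ + σ ^ 2) - h ^ 2 * σ ^ 2)

/-- The rescaled eliminant of `x2` from `f2` and `f3`. -/
def eliminant (h σ c : ℝ) : ℝ := elimLead h σ * c ^ 2 + elimLin h σ * c + elimConst h σ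

/-- The part of `numer` that does not depend on `c`. -/
def numerBase (h σ : ℝ) : ℝ := 4 - 2 * σ + h * (4 * σ + σ ^ 2) - 3 * h ^ 2 * σ ^ 2

/-- The numerator of `x2 / x12`, as given by `f2 = 0`. -/
def numer (h σ c : ℝ) : ℝ :=
  numerBase h σ + c * h ^ 2 * (6 - 2 * σ + 4 * h * σ) - (1 - 5 * h) * c ^ 2 * h ^ 3

/-- The denominator of `x2 / x12`, as given by `f2 = 0`, without the factor `x13`. -/
def denom (h σ : ℝ) : ℝ := 2 * (1 - h ^ 2 * σ ^ 2)

/-- The rescaled value of `f1` after the substitution of `x2`. -/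
def reduced (h σ c : ℝ) : ℝ :=
  ((1 + c * h ^ 2) * denom h σ - numer h σ c) * ((1 + c * h ^ 2) * denom h σ - 3 * numer h σ c)
    + (1 - 4 * h) * h * numer h σ c *
      (σ ^ 2 * (numer h σ c - denom h σ) + h ^ 2 * c ^ 2 * denom h σ)

/-- If a quadratic polynomial with positive leading coefficient is negative at `p` and positive at
`q > p`, then its larger root lies strictly between `p` and `q`. -/
lemma larger_root_mem_Ioo {a b c p q : ℝ} (ha : 0 < a) (hpq : p < q)
    (hp : a * p ^ 2 + b * p + c < 0) (hq : 0 < a * q ^ 2 + b * q + c) :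
    0 ≤ b ^ 2 - 4 * a * c ∧ p < (-b + √(b ^ 2 - 4 * a * c)) / (2 * a) ∧
      (-b + √(b ^ 2 - 4 * a * c)) / (2 * a) < q := by
  have hp' : (2 * a * p + b) ^ 2 < b ^ 2 - 4 * a * c := by nlinarith
  have hq' : b ^ 2 - 4 * a * c < (2 * a * q + b) ^ 2 := by nlinarith
  have hd : 0 ≤ b ^ 2 - 4 * a * c := (sq_nonneg _).trans hp'.le
  obtain ⟨h1, h2⟩ :=
    abs_lt.1 ((Real.lt_sqrt (abs_nonneg _)).2 ((sq_abs (2 * a * p + b)).trans_lt hp'))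
  have hs := Real.sq_sqrt hd
  refine ⟨hd, ?_, ?_⟩
  · rw [lt_div_iff₀ (by positivity)]; linarith
  · rw [div_lt_iff₀ (by positivity)]
    have : 2 * a * p < 2 * a * q := by gcongr
    by_contra! hcon
    nlinarith

lemma elimLead_pos {h σ : ℝ} (h0 : 0 < h) (h1 : h ≤ 1 / 9) (hσ0 : 0 ≤ σ) (hσ : σ ≤ 8 / 3) :
    0 < elimLead h σ := by
  have h2 : σ ^ 2 ≤ 8 := by nlinarith
  have : 0 < 4 - h * σ ^ 2 + h ^ 2 * σ ^ 2 := by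
    nlinarith [mul_nonneg h0.le (sub_nonneg.2 h2), sq_nonneg (h * σ)]
  unfold elimLead
  positivity

lemma elim_neg {h σ : ℝ} (h0 : 0 < h) (h1 : h ≤ 1 / 9) (hl : 5 / 3 + 9 / 2 * h ≤ σ)
    (hu : σ ≤ 8 / 3) : eliminant h σ (50 / 63) < 0 := by
  have hσ0 : 5 / 3 < σ := by linarith
  have key : 2 * σ ^ 2 * (1 - σ) + 100 / 63 * (4 - σ)
      + h * (4 * σ ^ 3 + σ ^ 4 + 200 / 63 * σ) < 0 := by
    rcases le_total σ (13 / 6) with hs | hs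
    · have : h * (4 * σ ^ 3 + σ ^ 4 + 200 / 63 * σ)
          ≤ (σ - 5 / 3) * 2 / 9 * (4 * σ ^ 3 + σ ^ 4 + 200 / 63 * σ) := by
        gcongr
        linarith
      have h3 : 4 * σ ^ 3 + σ ^ 4 + 200 / 63 * σ - 9 / 2 * (2 * σ ^ 2 + 4 / 3 * σ + 80 / 21) < 0 := by
        nlinarith [mul_nonneg (sub_nonneg.2 hσ0.le) (sub_nonneg.2 hs),
          mul_nonneg (mul_nonneg (sub_nonneg.2 hσ0.le) (sub_nonneg.2 hs)) (by linarith : 0 ≤ σ),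
          mul_nonneg (mul_nonneg (sub_nonneg.2 hσ0.le) (sub_nonneg.2 hs)) (sq_nonneg σ)]
      nlinarith [mul_pos (sub_pos.2 hσ0) (neg_pos.2 h3)]
    · have : h * (4 * σ ^ 3 + σ ^ 4 + 200 / 63 * σ)
          ≤ 1 / 9 * (4 * σ ^ 3 + σ ^ 4 + 200 / 63 * σ) := by
        gcongr
      nlinarith [mul_nonneg (sub_nonneg.2 hs) (sub_nonneg.2 hu),
          mul_nonneg (mul_nonneg (sub_nonneg.2 hs) (sub_nonneg.2 hu)) (by linarith : 0 ≤ σ),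
          mul_nonneg (mul_nonneg (sub_nonneg.2 hs) (sub_nonneg.2 hu)) (sq_nonneg σ)]
  have h2 : 0 ≤ h ^ 2 * (σ ^ 4 + 100 / 63 * σ ^ 2
      - (50 / 63) ^ 2 * (4 - h * σ ^ 2 + h ^ 2 * σ ^ 2)) := by
    have h3 : 25 / 9 ≤ σ ^ 2 := by nlinarith
    have h4 : 0 ≤ h * (1 - h) * σ ^ 2 := by
      have : 0 ≤ 1 - h := by linarith
      positivity
    refine mul_nonneg (sq_nonneg h) ?_
    nlinarith [sq_nonneg (σ ^ 2)]
  unfold eliminant elimLead elimLin elimConst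
  linarith

lemma elim_pos {h σ : ℝ} (h0 : 0 < h) (h1 : h ≤ 1 / 9) (hl : 5 / 3 ≤ σ)
    (hu : σ ≤ 5 / 3 + 9 * h) : 0 < eliminant h σ 3 := by
  obtain ⟨τ, rfl⟩ : ∃ τ, σ = 5 / 3 + τ := ⟨σ - 5 / 3, by ring⟩
  have t0 : 0 ≤ τ := by linarith
  have t1 : 0 ≤ 1 - τ := by linarith
  have key : 0 < 2 * (5 / 3 + τ) ^ 2 * (1 - (5 / 3 + τ)) + 6 * (4 - (5 / 3 + τ))
      + τ / 9 * (4 * (5 / 3 + τ) ^ 3 + (5 / 3 + τ) ^ 4 + 12 * (5 / 3 + τ)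
        - 1 / 9 * ((5 / 3 + τ) ^ 4 + 7 * (5 / 3 + τ) ^ 2)) := by
    nlinarith [mul_nonneg t0 t1, mul_nonneg (mul_nonneg t0 t1) t0, mul_nonneg (mul_nonneg t0 t1) t1,
      mul_nonneg (mul_nonneg t0 t1) (sq_nonneg τ), mul_nonneg (mul_nonneg t0 t1) (pow_nonneg t0 3),
      sq_nonneg (τ - 9 / 10), mul_nonneg t0 (sq_nonneg (τ - 9 / 10))]
  set σ := 5 / 3 + τ with hσ
  have h2 : τ / 9 * (4 * σ ^ 3 + σ ^ 4 + 12 * σ - 1 / 9 * (σ ^ 4 + 7 * σ ^ 2))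
      ≤ h * (4 * σ ^ 3 + σ ^ 4 + 12 * σ - h * (σ ^ 4 + 7 * σ ^ 2)) := by
    have h3 : 0 ≤ 4 * σ ^ 3 + σ ^ 4 + 12 * σ - 1 / 9 * (σ ^ 4 + 7 * σ ^ 2) := by
      have : 0 ≤ σ := by linarith
      nlinarith [pow_nonneg this 3, pow_nonneg this 4, pow_nonneg this 2]
    gcongr
    linarith
  have h4 : 0 ≤ h ^ 2 * (σ ^ 2 * (1 - 9 * h) + 36 + 9 * h ^ 2 * σ ^ 2) := by
    have : 0 ≤ 1 - 9 * h := by linarith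
    positivity
  unfold eliminant elimLead elimLin elimConst
  linarith

lemma numer_mem_Icc {h σ c : ℝ} (h0 : 0 < h) (h1 : h ≤ 1 / 9) (hl : 5 / 3 + 9 / 2 * h ≤ σ)
    (hu : σ ≤ 8 / 3) (c0 : 0 ≤ c) (c1 : c ≤ 3) :
    numer h σ c ∈ Set.Icc (numerBase h σ) (numerBase h σ + 9 * h ^ 2) := by
  have hc : 0 ≤ c * h := by positivity
  have hcu : c * h ≤ 1 / 3 := by nlinarith
  have hf : 0 ≤ 1 - 5 * h := by linarith
  have h2 : 0 ≤ 6 - 2 * σ + 4 * h * σ - (1 - 5 * h) * (c * h) := by nlinarith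
  have h3 : 6 - 2 * σ + 4 * h * σ - (1 - 5 * h) * (c * h) ≤ 3 := by
    nlinarith [mul_nonneg hf hc]
  have h4 : c * h ^ 2 * (6 - 2 * σ + 4 * h * σ - (1 - 5 * h) * (c * h)) ≤ 3 * h ^ 2 * 3 := by
    gcongr
  have h5 : 0 ≤ c * h ^ 2 * (6 - 2 * σ + 4 * h * σ - (1 - 5 * h) * (c * h)) := by positivity
  unfold numer
  constructor <;> linarith

lemma numerBase_pos {h σ : ℝ} (h0 : 0 < h) (h1 : h ≤ 1 / 9) (hl : 5 / 3 ≤ σ)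
    (hu : σ ≤ 5 / 3 + 9 * h) : 0 < numerBase h σ := by
  have h2 : (5 / 3 : ℝ) ^ 2 * (h * (1 - 3 * h)) ≤ σ ^ 2 * (h * (1 - 3 * h)) := by
    have : 0 ≤ 1 - 3 * h := by linarith
    gcongr
  have h3 : σ * (1 - 2 * h) ≤ (5 / 3 + 9 * h) * (1 - 2 * h) := by
    have : 0 ≤ 1 - 2 * h := by linarith
    gcongr
  unfold numerBase
  nlinarith [sq_nonneg (h - 1 / 8)]

lemma denom_ge {h σ : ℝ} (h0 : 0 < h) (h1 : h ≤ 1 / 9) (hσ0 : 0 ≤ σ) (hσ : σ ≤ 8 / 3) :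
    3 / 2 ≤ denom h σ := by
  have : h ^ 2 * σ ^ 2 ≤ (1 / 9) ^ 2 * (8 / 3) ^ 2 := by gcongr
  unfold denom
  linarith

lemma reduced_neg {h c : ℝ} (h0 : 0 < h) (h1 : h ≤ 1 / 9) (c0 : 0 ≤ c) (c1 : c ≤ 3) :
    reduced h (5 / 3 + 9 / 2 * h) c < 0 := by
  have hb := numer_mem_Icc h0 h1 le_rfl (by linarith) c0 c1
  have hb0 := numerBase_pos h0 h1 (by linarith : 5 / 3 ≤ 5 / 3 + 9 / 2 * h) (by linarith)
  unfold reduced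
  set b := numer h (5 / 3 + 9 / 2 * h) c
  obtain ⟨hb1, hb2⟩ := hb
  have bpos : 0 < b := hb0.trans_le hb1
  have hd1 := denom_ge h0 h1 (by linarith : 0 ≤ 5 / 3 + 9 / 2 * h) (by linarith)
  have hd2 : denom h (5 / 3 + 9 / 2 * h) ≤ 2 := by
    unfold denom
    nlinarith [sq_nonneg (h * (5 / 3 + 9 / 2 * h))]
  have hb3 : b ≤ 11 / 10 := by
    unfold numerBase at hb2
    have := sub_nonneg.2 h1
    nlinarith [pow_pos h0 2, pow_pos h0 3, mul_nonneg h0.le this,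
      mul_nonneg (pow_pos h0 2).le this, pow_pos h0 4]
  have hch : 0 ≤ c * h ^ 2 := by positivity
  have hch3 : c * h ^ 2 ≤ 3 * h ^ 2 := by gcongr
  have hy : (1 + c * h ^ 2) * denom h (5 / 3 + 9 / 2 * h) < 3 * b := by
    have h2 : (1 + c * h ^ 2) * denom h (5 / 3 + 9 / 2 * h)
        ≤ (1 + 3 * h ^ 2) * denom h (5 / 3 + 9 / 2 * h) := by gcongr
    have h3 : (1 + 3 * h ^ 2) * denom h (5 / 3 + 9 / 2 * h)
        < 3 * numerBase h (5 / 3 + 9 / 2 * h) := by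
      unfold denom numerBase
      have := sub_nonneg.2 h1
      nlinarith [pow_pos h0 2, pow_pos h0 3, pow_pos h0 4, mul_nonneg (pow_pos h0 2).le this,
        mul_nonneg (pow_pos h0 3).le this]
    linarith
  have hy' : b < (1 + c * h ^ 2) * denom h (5 / 3 + 9 / 2 * h) := by nlinarith
  set d := denom h (5 / 3 + 9 / 2 * h)
  have h4 : (5 / 3 + 9 / 2 * h) ^ 2 * (b - d) + h ^ 2 * c ^ 2 * d ≤ 0 := by
    have h5 : h ^ 2 * c ^ 2 ≤ (1 / 9) ^ 2 * 3 ^ 2 := by gcongr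
    nlinarith [mul_nonneg h0.le (by linarith : 0 ≤ d - b), sq_nonneg h,
      mul_nonneg (sq_nonneg h) (by linarith : 0 ≤ d - b)]
  have h6 : 0 ≤ (1 - 4 * h) * h * b := by
    have : 0 ≤ 1 - 4 * h := by linarith
    positivity
  have h7 := mul_nonpos_of_nonneg_of_nonpos h6 h4
  have h8 := mul_neg_of_pos_of_neg (sub_pos.2 hy') (sub_neg.2 hy)
  linarith

lemma reduced_pos {h c : ℝ} (h0 : 0 < h) (h1 : h ≤ 1 / 9) (c0 : 0 ≤ c) (c1 : c ≤ 3) :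
    0 < reduced h (5 / 3 + 9 * h) c := by
  have hb := numer_mem_Icc h0 h1 (by linarith : 5 / 3 + 9 / 2 * h ≤ 5 / 3 + 9 * h)
    (by linarith) c0 c1
  have hb0 := numerBase_pos h0 h1 (by linarith : 5 / 3 ≤ 5 / 3 + 9 * h) (by linarith)
  unfold reduced
  set b := numer h (5 / 3 + 9 * h) c
  obtain ⟨hb1, hb2⟩ := hb
  have bpos : 0 < b := hb0.trans_le hb1
  have hch : 0 ≤ c * h ^ 2 := by positivity
  have h14 : 0 ≤ 1 - 4 * h := by linarith
  have key : 0 < denom h (5 / 3 + 9 * h)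
      - (numerBase h (5 / 3 + 9 * h) + 9 * h ^ 2) * (3 + (1 - 4 * h) * h * (5 / 3 + 9 * h) ^ 2) := by
    unfold denom numerBase
    have := sub_nonneg.2 h1
    nlinarith [pow_pos h0 2, pow_pos h0 3, pow_pos h0 4, mul_nonneg (pow_pos h0 2).le this,
        mul_nonneg (pow_pos h0 3).le this, mul_nonneg (pow_pos h0 4).le this, mul_nonneg h0.le this,
        mul_nonneg (pow_pos h0 5).le this, mul_nonneg (pow_pos h0 6).le this]
  have hm : b * (3 + (1 - 4 * h) * h * (5 / 3 + 9 * h) ^ 2)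
      ≤ (numerBase h (5 / 3 + 9 * h) + 9 * h ^ 2) * (3 + (1 - 4 * h) * h * (5 / 3 + 9 * h) ^ 2) := by
    gcongr
  set d := denom h (5 / 3 + 9 * h)
  have hw : 0 ≤ (1 - 4 * h) * h * b * (5 / 3 + 9 * h) ^ 2 := by positivity
  have hd3 : 0 < d - 3 * b - (1 - 4 * h) * h * b * (5 / 3 + 9 * h) ^ 2 := by linarith
  have hdb : 0 < d - b := by linarith
  have hd : 0 < d := by linarith
  have hy : d ≤ (1 + c * h ^ 2) * d := by nlinarith
  have h2 : (d - b) * (d - 3 * b) ≤ ((1 + c * h ^ 2) * d - b) * ((1 + c * h ^ 2) * d - 3 * b) := by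
    have : 0 ≤ d - 3 * b := by linarith
    have : 0 ≤ (1 + c * h ^ 2) * d - b := by linarith
    gcongr
  have h3 : 0 ≤ (1 - 4 * h) * h * b * (h ^ 2 * c ^ 2 * d) := by positivity
  nlinarith [mul_pos hdb hd3]

/-- The rescaled system has a solution in the required range. -/
lemma exists_rescaled_solution {h : ℝ} (h0 : 0 < h) (h1 : h ≤ 1 / 9) :
    ∃ σ c : ℝ, 5 / 3 + 9 / 2 * h ≤ σ ∧ σ ≤ 5 / 3 + 9 * h ∧ 50 / 63 < c ∧ c < 3 ∧
      eliminant h σ c = 0 ∧ reduced h σ c = 0 := by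
  let r : ℝ → ℝ := fun σ =>
    (-elimLin h σ + √(elimLin h σ ^ 2 - 4 * elimLead h σ * elimConst h σ)) / (2 * elimLead h σ)
  have hlead : ∀ σ ∈ Set.Icc (5 / 3 + 9 / 2 * h) (5 / 3 + 9 * h), 0 < elimLead h σ :=
    fun σ hσ => elimLead_pos h0 h1 (by linarith [hσ.1]) (by linarith [hσ.2])
  have hr : ∀ σ ∈ Set.Icc (5 / 3 + 9 / 2 * h) (5 / 3 + 9 * h),
      0 ≤ elimLin h σ ^ 2 - 4 * elimLead h σ * elimConst h σ ∧ 50 / 63 < r σ ∧ r σ < 3 :=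
    fun σ hσ => larger_root_mem_Ioo (hlead σ hσ) (by norm_num)
      (elim_neg h0 h1 hσ.1 (by linarith [hσ.2])) (elim_pos h0 h1 (by linarith [hσ.1]) hσ.2)
  have hcr : ContinuousOn r (Set.Icc (5 / 3 + 9 / 2 * h) (5 / 3 + 9 * h)) := by
    apply ContinuousOn.div
    · unfold elimLin elimLead elimConst
      fun_prop
    · unfold elimLead
      fun_prop
    · intro σ hσ
      have := hlead σ hσ
      positivity
  have hcont : ContinuousOn (fun σ => reduced h σ (r σ))
      (Set.Icc (5 / 3 + 9 / 2 * h) (5 / 3 + 9 * h)) := by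
    unfold reduced numer numerBase denom
    fun_prop
  have hle : 5 / 3 + 9 / 2 * h ≤ 5 / 3 + 9 * h := by linarith
  obtain ⟨-, hl1, hl2⟩ := hr _ (Set.left_mem_Icc.2 hle)
  obtain ⟨-, hu1, hu2⟩ := hr _ (Set.right_mem_Icc.2 hle)
  obtain ⟨σ, hσ, hσ0⟩ := intermediate_value_Icc hle hcont
    ⟨(reduced_neg h0 h1 (by linarith) hl2.le).le, (reduced_pos h0 h1 (by linarith) hu2.le).le⟩
  obtain ⟨hdisc, hr1, hr2⟩ := hr σ hσ
  refine ⟨σ, r σ, hσ.1, hσ.2, hr1, hr2, ?_, hσ0⟩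
  have hne := (hlead σ hσ).ne'
  have hs := Real.mul_self_sqrt hdisc
  have hroot := (quadratic_eq_zero_iff hne
    (s := √(elimLin h σ ^ 2 - 4 * elimLead h σ * elimConst h σ))
    (by rw [hs, discrim]) (r σ)).2 (Or.inl rfl)
  unfold eliminant
  linear_combination hroot

/-- For every integer `n ≥ 9` there is a solution of `f1 = f2 = f3 = 0` with
`x2, x12 > 0` and `1 + 50/(63n²) < x13 < 1 + 3/n²`. -/
theorem stmt14 (n : ℕ) (hn : 9 ≤ n) :
    ∃ x2 x12 x13 : ℝ, 0 < x2 ∧ 0 < x12 ∧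
      1 + 50 / (63 * (n : ℝ) ^ 2) < x13 ∧ x13 < 1 + 3 / (n : ℝ) ^ 2 ∧
      f1 n x2 x12 x13 = 0 ∧ f2 n x2 x12 x13 = 0 ∧ f3 n x2 x12 x13 = 0 := by
  have hn' : (9 : ℝ) ≤ n := by exact_mod_cast hn
  have hnpos : (0 : ℝ) < n := by linarith
  obtain ⟨h, hh⟩ : ∃ h : ℝ, h = 1 / n := ⟨_, rfl⟩
  have h0 : 0 < h := by rw [hh]; positivity
  have h1 : h ≤ 1 / 9 := by rw [hh]; gcongr
  have hnh : (n : ℝ) = 1 / h := by rw [hh]; field_simp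
  obtain ⟨σ, c, hσl, hσu, hcl, hcu, he, hred⟩ := exists_rescaled_solution h0 h1
  have hb : 0 < numer h σ c := (numerBase_pos h0 h1 (by linarith) hσu).trans_le
    (numer_mem_Icc h0 h1 hσl (by linarith) (by linarith) hcu.le).1
  have ha : 0 < 1 + c * h ^ 2 := by
    have : 0 < c := by linarith
    positivity
  have hσ : 0 < σ := by linarith
  have hd : 0 < denom h σ := by linarith [denom_ge h0 h1 hσ.le (by linarith)]
  rw [hnh]
  obtain ⟨z, hz⟩ : ∃ z, z = numer h σ c / ((1 + c * h ^ 2) * denom h σ) := ⟨_, rfl⟩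
  have hz0 : 0 < z := by rw [hz]; positivity
  have hzb : numer h σ c = z * ((1 + c * h ^ 2) * denom h σ) := by rw [hz]; field_simp
  refine ⟨h * σ * z, h * σ, 1 + c * h ^ 2, by positivity, by positivity, ?_, ?_, ?_, ?_, ?_⟩
  · have : 50 / (63 * (1 / h) ^ 2) = 50 / 63 * h ^ 2 := by field_simp
    rw [this]
    gcongr
  · have : 3 / (1 / h) ^ 2 = 3 * h ^ 2 := by field_simp
    rw [this]
    gcongr
  · have hf1 : f1 (1 / h) (h * σ * z) (h * σ) (1 + c * h ^ 2)
        * ((1 + c * h ^ 2) * denom h σ) ^ 2 = h ^ 2 * σ ^ 2 * (1 + c * h ^ 2) * reduced h σ c := by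
      unfold f1 reduced
      rw [hzb]
      field_simp
      ring
    rw [hred, mul_zero] at hf1
    exact (mul_eq_zero.1 hf1).resolve_right (by positivity)
  · have hf2 : f2 (1 / h) (h * σ * z) (h * σ) (1 + c * h ^ 2)
        = h * σ * (numer h σ c - z * ((1 + c * h ^ 2) * denom h σ)) := by
      unfold f2 numer numerBase denom
      field_simp
      ring
    rw [hf2, hzb, sub_self, mul_zero]
  · have hf3 : f3 (1 / h) (h * σ * z) (h * σ) (1 + c * h ^ 2) * denom h σ
        = h ^ 2 * σ ^ 2 * (numer h σ c - z * ((1 + c * h ^ 2) * denom h σ))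
          - h ^ 2 * eliminant h σ c := by
      unfold f3 numer numerBase denom eliminant elimLead elimLin elimConst
      field_simp
      ring
    rw [he, hzb, sub_self, mul_zero, mul_zero, sub_zero] at hf3
    exact (mul_eq_zero.1 hf3).resolve_right hd.ne'
end

section
/- There exist real numbers x1, x2, x12, x13 with 0.45 < x1 < 0.46, 0.12 < x2 < 0.13, 1.02 < x12 < 1.04 and 0.34 < x13 < 0.36 satisfying g1 = 0, g2 = 0, g3 = 0 and g4 = 0; in particular the system has a second solution in positive reals with x13 ≠ 1. -/
/-- `g1` from the Einstein equations for `V₅ℝ⁷ = SO(7)/SO(2)`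
(Ad(SO(2)×SO(3)×SO(2))-invariant metrics, normalization `x23 = 1`). -/
def g1 (x1 x2 x12 x13 : ℝ) : ℝ :=
  2 * x1 * x12 ^ 2 * x2 + 3 * x1 * x13 ^ 2 * x2 - 2 * x12 ^ 2 * x13 ^ 2 * x2 ^ 2
    - x12 ^ 2 * x13 ^ 2 - 2 * x13 ^ 2 * x2 ^ 2

/-- `g2` from the Einstein equations for `V₅ℝ⁷`. -/
def g2 (x1 x2 x12 x13 : ℝ) : ℝ :=
  x1 * x13 * x2 - 2 * x12 ^ 3 * x2 + 2 * x12 ^ 2 * x13 * x2 ^ 2 + x12 ^ 2 * x13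
    + 2 * x12 * x13 ^ 2 * x2 - 10 * x12 * x13 * x2 + 2 * x12 * x2 + 4 * x13 * x2 ^ 2

/-- `g3` from the Einstein equations for `V₅ℝ⁷`. -/
def g3 (x1 x2 x12 x13 : ℝ) : ℝ :=
  -x1 * x13 + 4 * x12 ^ 3 + 2 * x12 ^ 2 * x13 * x2 - 10 * x12 ^ 2 * x13
    + 10 * x12 * x13 - 4 * x12 - 2 * x13 * x2

/-- `g4` from the Einstein equations for `V₅ℝ⁷`. -/
def g4 (x1 x2 x12 x13 : ℝ) : ℝ :=
  x1 * x12 + x12 ^ 2 * x13 - 2 * x12 * x13 ^ 2 * x2 + 10 * x12 * x13 ^ 2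
    - 10 * x12 * x13 - 5 * x13 ^ 3 + 5 * x13

open Metric in
/-- A map that is a small Lipschitz perturbation of the identity on a closed ball and is small at
the centre has a zero in that ball. -/
theorem exists_mem_closedBall_eq_zero_of_approximatesLinearOn_id {E : Type*}
    [NormedAddCommGroup E] [NormedSpace ℝ E] [CompleteSpace E] {F : E → E} {b : E} {ε : ℝ}
    {c : NNReal} (hε : 0 ≤ ε)
    (hF : ApproximatesLinearOn F (ContinuousLinearMap.id ℝ E) (closedBall b ε) c)
    (hb : ‖F b‖ ≤ (1 - c) * ε) : ∃ x ∈ closedBall b ε, F x = 0 := by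
  let idInv : (ContinuousLinearMap.id ℝ E).NonlinearRightInverse :=
    { toFun := id
      nnnorm := 1
      bound' := fun y => by simp
      right_inv' := fun y => rfl }
  have h := hF.surjOn_closedBall_of_nonlinearRightInverse idInv hε subset_rfl
  have h0 : (0 : E) ∈ closedBall (F b) (((idInv.nnnorm : ℝ)⁻¹ - c) * ε) := by
    simpa [idInv, mem_closedBall, dist_eq_norm] using hb
  exact h h0

/-- `p` and `q` are within `R` of `c`, their difference is at most `L * d`, and it equals `l`
up to an error of at most `E * d`. -/
structure AffineApprox (d p q c R l L E : ℝ) : Prop where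
  left : |p - c| ≤ R
  right : |q - c| ≤ R
  lip : |p - q| ≤ L * d
  err : |p - q - l| ≤ E * d

namespace AffineApprox

variable {d p q c R l L E p' q' c' R' l' L' E' : ℝ}

theorem add (h : AffineApprox d p q c R l L E) (h' : AffineApprox d p' q' c' R' l' L' E') :
    AffineApprox d (p + p') (q + q') (c + c') (R + R') (l + l') (L + L') (E + E') where
  left := by
    rw [show p + p' - (c + c') = (p - c) + (p' - c') by ring]
    exact (abs_add_le _ _).trans (add_le_add h.left h'.left)
  right := by
    rw [show q + q' - (c + c') = (q - c) + (q' - c') by ring]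
    exact (abs_add_le _ _).trans (add_le_add h.right h'.right)
  lip := by
    rw [show p + p' - (q + q') = (p - q) + (p' - q') by ring, add_mul]
    exact (abs_add_le _ _).trans (add_le_add h.lip h'.lip)
  err := by
    rw [show p + p' - (q + q') - (l + l') = (p - q - l) + (p' - q' - l') by ring, add_mul]
    exact (abs_add_le _ _).trans (add_le_add h.err h'.err)

theorem neg (h : AffineApprox d p q c R l L E) :
    AffineApprox d (-p) (-q) (-c) R (-l) L E where
  left := by rw [← neg_sub', abs_neg]; exact h.left
  right := by rw [← neg_sub', abs_neg]; exact h.right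
  lip := by rw [← neg_sub', abs_neg]; exact h.lip
  err := by rw [← neg_sub', ← neg_sub', abs_neg]; exact h.err

theorem sub (h : AffineApprox d p q c R l L E) (h' : AffineApprox d p' q' c' R' l' L' E') :
    AffineApprox d (p - p') (q - q') (c - c') (R + R') (l - l') (L + L') (E + E') := by
  simpa only [sub_eq_add_neg] using h.add h'.neg

theorem const (d a : ℝ) : AffineApprox d a a a 0 0 0 0 := by
  constructor <;> simp

theorem mul (h : AffineApprox d p q c R l L E) (h' : AffineApprox d p' q' c' R' l' L' E') :
    AffineApprox d (p * p') (q * q') (c * c') (|c| * R' + |c'| * R + R * R') (c * l' + c' * l)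
      ((|c| + R) * L' + (|c'| + R') * L) (|c| * E' + |c'| * E + R * L' + R' * L) := by
  have hR : 0 ≤ R := (abs_nonneg _).trans h.left
  have hR' : 0 ≤ R' := (abs_nonneg _).trans h'.left
  have bound : ∀ u u', |u - c| ≤ R → |u' - c'| ≤ R' →
      |u * u' - c * c'| ≤ |c| * R' + |c'| * R + R * R' := fun u u' hu hu' => by
    calc |u * u' - c * c'| = |c * (u' - c') + c' * (u - c) + (u - c) * (u' - c')| := by
          congr 1; ring
      _ ≤ |c * (u' - c')| + |c' * (u - c)| + |(u - c) * (u' - c')| := abs_add_three _ _ _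
      _ ≤ _ := by simp only [abs_mul]; gcongr
  refine ⟨bound p p' h.left h'.left, bound q q' h.right h'.right, ?_, ?_⟩
  · have hp : |p| ≤ |c| + R := by linarith [abs_sub_abs_le_abs_sub p c, h.left]
    have hq' : |q'| ≤ |c'| + R' := by linarith [abs_sub_abs_le_abs_sub q' c', h'.right]
    calc |p * p' - q * q'| = |p * (p' - q') + q' * (p - q)| := by congr 1; ring
      _ ≤ |p * (p' - q')| + |q' * (p - q)| := abs_add_le _ _
      _ = |p| * |p' - q'| + |q'| * |p - q| := by simp only [abs_mul]
      _ ≤ (|c| + R) * (L' * d) + (|c'| + R') * (L * d) := by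
          gcongr
          exacts [h'.lip, h.lip]
      _ = _ := by ring
  · calc |p * p' - q * q' - (c * l' + c' * l)|
        = |(c * (p' - q' - l') + c' * (p - q - l))
            + ((p - c) * (p' - q') + (q' - c') * (p - q))| := by congr 1; ring
      _ ≤ (|c * (p' - q' - l')| + |c' * (p - q - l)|)
            + (|(p - c) * (p' - q')| + |(q' - c') * (p - q)|) :=
          (abs_add_le _ _).trans (add_le_add (abs_add_le _ _) (abs_add_le _ _))
      _ ≤ (|c| * (E' * d) + |c'| * (E * d)) + (R * (L' * d) + R' * (L * d)) := by
          simp only [abs_mul]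
          gcongr
          exacts [h'.err, h.err, h.left, h'.lip, h'.right, h.lip]
      _ = _ := by ring

theorem sq (h : AffineApprox d p q c R l L E) :
    AffineApprox d (p ^ 2) (q ^ 2) (c * c) (|c| * R + |c| * R + R * R) (c * l + c * l)
      ((|c| + R) * L + (|c| + R) * L) (|c| * E + |c| * E + R * L + R * L) := by
  simpa only [pow_two] using h.mul h

theorem cube (h : AffineApprox d p q c R l L E) :
    AffineApprox d (p ^ 3) (q ^ 3) (c * c * c)
      (|c * c| * R + |c| * (|c| * R + |c| * R + R * R) + (|c| * R + |c| * R + R * R) * R)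
      (c * c * l + c * (c * l + c * l))
      ((|c * c| + (|c| * R + |c| * R + R * R)) * L
        + (|c| + R) * ((|c| + R) * L + (|c| + R) * L))
      (|c * c| * E + |c| * (|c| * E + |c| * E + R * L + R * L)
        + (|c| * R + |c| * R + R * R) * L + R * ((|c| + R) * L + (|c| + R) * L)) := by
  simpa only [pow_succ, pow_zero, one_mul] using (h.mul h).mul h

end AffineApprox

/-- A rational approximation of the solution. -/
noncomputable def approxSolution : Fin 4 → ℝ :=
  ![4556 / 10000, 1213 / 10000, 10322 / 10000, 3501 / 10000]

theorem approxSolution_zero : approxSolution 0 = 4556 / 10000 := rfl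

theorem approxSolution_one : approxSolution 1 = 1213 / 10000 := rfl

theorem approxSolution_two : approxSolution 2 = 10322 / 10000 := rfl

theorem approxSolution_three : approxSolution 3 = 3501 / 10000 := rfl

section LinearApproximation

variable {d : ℝ} {x y : Fin 4 → ℝ}

theorem abs_g1_sub_sub_le
    (h : ∀ i, AffineApprox d (x i) (y i) (approxSolution i) (1 / 5000) (x i - y i) 1 0) :
    |g1 (x 0) (x 1) (x 2) (x 3) - g1 (y 0) (y 1) (y 2) (y 3)
      - (303 / 1000 * (x 0 - y 0) + 1016 / 1000 * (x 1 - y 1)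
        + (-32 / 1000) * (x 2 - y 2) + (-672 / 1000) * (x 3 - y 3))| ≤ 7 / 1000 * d := by
  have h0 := h 0
  have h1 := h 1
  have h2 := h 2
  have h3 := h 3
  rw [approxSolution_zero] at h0
  rw [approxSolution_one] at h1
  rw [approxSolution_two] at h2
  rw [approxSolution_three] at h3
  have k (a : ℝ) := AffineApprox.const d a
  have e :=
    ((((k 2).mul h0).mul h2.sq).mul h1)
      |>.add ((((k 3).mul h0).mul h3.sq).mul h1)
      |>.sub ((((k 2).mul h2.sq).mul h3.sq).mul h1.sq)
      |>.sub (h2.sq.mul h3.sq)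
      |>.sub (((k 2).mul h3.sq).mul h1.sq)
  have f := abs_le.1 e.err
  have b0 := abs_le.1 h0.lip
  have b1 := abs_le.1 h1.lip
  have b2 := abs_le.1 h2.lip
  have b3 := abs_le.1 h3.lip
  clear e k h0 h1 h2 h3 h
  rw [← g1, ← g1] at f
  norm_num only [abs_mul, abs_neg, Nat.abs_ofNat, abs_div, abs_one] at f
  rw [abs_le]
  constructor <;> linarith

theorem abs_g2_sub_sub_le
    (h : ∀ i, AffineApprox d (x i) (y i) (approxSolution i) (1 / 5000) (x i - y i) 1 0) :
    |g2 (x 0) (x 1) (x 2) (x 3) - g2 (y 0) (y 1) (y 2) (y 3)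
      - (42 / 1000 * (x 0 - y 0) + (-2816 / 1000) * (x 1 - y 1)
        + (-184 / 1000) * (x 2 - y 2) + 134 / 1000 * (x 3 - y 3))| ≤ 17 / 1000 * d := by
  have h0 := h 0
  have h1 := h 1
  have h2 := h 2
  have h3 := h 3
  rw [approxSolution_zero] at h0
  rw [approxSolution_one] at h1
  rw [approxSolution_two] at h2
  rw [approxSolution_three] at h3
  have k (a : ℝ) := AffineApprox.const d a
  have e :=
    ((h0.mul h3).mul h1).sub (((k 2).mul h2.cube).mul h1)
      |>.add ((((k 2).mul h2.sq).mul h3).mul h1.sq)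
      |>.add (h2.sq.mul h3)
      |>.add ((((k 2).mul h2).mul h3.sq).mul h1)
      |>.sub ((((k 10).mul h2).mul h3).mul h1)
      |>.add (((k 2).mul h2).mul h1)
      |>.add (((k 4).mul h3).mul h1.sq)
  have f := abs_le.1 e.err
  have b0 := abs_le.1 h0.lip
  have b1 := abs_le.1 h1.lip
  have b2 := abs_le.1 h2.lip
  have b3 := abs_le.1 h3.lip
  clear e k h0 h1 h2 h3 h
  rw [← g2, ← g2] at f
  norm_num only [abs_mul, abs_neg, Nat.abs_ofNat, abs_div, abs_one] at f
  rw [abs_le]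
  constructor <;> linarith

theorem abs_g3_sub_sub_le
    (h : ∀ i, AffineApprox d (x i) (y i) (approxSolution i) (1 / 5000) (x i - y i) 1 0) :
    |g3 (x 0) (x 1) (x 2) (x 3) - g3 (y 0) (y 1) (y 2) (y 3)
      - ((-350 / 1000) * (x 0 - y 0) + 46 / 1000 * (x 1 - y 1)
        + 5234 / 1000 * (x 2 - y 2) + (-772 / 1000) * (x 3 - y 3))| ≤ 25 / 1000 * d := by
  have h0 := h 0
  have h1 := h 1
  have h2 := h 2
  have h3 := h 3
  rw [approxSolution_zero] at h0
  rw [approxSolution_one] at h1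
  rw [approxSolution_two] at h2
  rw [approxSolution_three] at h3
  have k (a : ℝ) := AffineApprox.const d a
  have e :=
    (h0.neg.mul h3).add ((k 4).mul h2.cube)
      |>.add ((((k 2).mul h2.sq).mul h3).mul h1)
      |>.sub (((k 10).mul h2.sq).mul h3)
      |>.add (((k 10).mul h2).mul h3)
      |>.sub ((k 4).mul h2)
      |>.sub (((k 2).mul h3).mul h1)
  have f := abs_le.1 e.err
  have b0 := abs_le.1 h0.lip
  have b1 := abs_le.1 h1.lip
  have b2 := abs_le.1 h2.lip
  have b3 := abs_le.1 h3.lip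
  clear e k h0 h1 h2 h3 h
  rw [← g3, ← g3] at f
  norm_num only [abs_mul, abs_neg, Nat.abs_ofNat, abs_div, abs_one] at f
  rw [abs_le]
  constructor <;> linarith

theorem abs_g4_sub_sub_le
    (h : ∀ i, AffineApprox d (x i) (y i) (approxSolution i) (1 / 5000) (x i - y i) 1 0) :
    |g4 (x 0) (x 1) (x 2) (x 3) - g4 (y 0) (y 1) (y 2) (y 3)
      - (1032 / 1000 * (x 0 - y 0) + (-253 / 1000) * (x 1 - y 1)
        + (-1127 / 1000) * (x 2 - y 2) + 957 / 1000 * (x 3 - y 3))| ≤ 19 / 1000 * d := by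
  have h0 := h 0
  have h1 := h 1
  have h2 := h 2
  have h3 := h 3
  rw [approxSolution_zero] at h0
  rw [approxSolution_one] at h1
  rw [approxSolution_two] at h2
  rw [approxSolution_three] at h3
  have k (a : ℝ) := AffineApprox.const d a
  have e :=
    (h0.mul h2).add (h2.sq.mul h3)
      |>.sub ((((k 2).mul h2).mul h3.sq).mul h1)
      |>.add (((k 10).mul h2).mul h3.sq)
      |>.sub (((k 10).mul h2).mul h3)
      |>.sub ((k 5).mul h3.cube)
      |>.add ((k 5).mul h3)
  have f := abs_le.1 e.err
  have b0 := abs_le.1 h0.lip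
  have b1 := abs_le.1 h1.lip
  have b2 := abs_le.1 h2.lip
  have b3 := abs_le.1 h3.lip
  clear e k h0 h1 h2 h3 h
  rw [← g4, ← g4] at f
  norm_num only [abs_mul, abs_neg, Nat.abs_ofNat, abs_div, abs_one] at f
  rw [abs_le]
  constructor <;> linarith

end LinearApproximation

/-- The system preconditioned by an approximate inverse of its Jacobian at the solution. -/
noncomputable def preconditioned (x : Fin 4 → ℝ) : Fin 4 → ℝ :=
  let a := g1 (x 0) (x 1) (x 2) (x 3)
  let b := g2 (x 0) (x 1) (x 2) (x 3)
  let c := g3 (x 0) (x 1) (x 2) (x 3)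
  let e := g4 (x 0) (x 1) (x 2) (x 3)
  ![23 / 25 * a + 27 / 100 * b + 9 / 50 * c + 3 / 4 * e,
    -3 / 100 * a - 37 / 100 * b - 1 / 100 * c + 1 / 50 * e,
    -1 / 10 * a - 1 / 25 * b + 21 / 100 * c + 1 / 10 * e,
    -28 / 25 * a - 11 / 25 * b + 3 / 50 * c + 37 / 100 * e]

open Metric in
theorem approximatesLinearOn_preconditioned :
    ApproximatesLinearOn preconditioned (ContinuousLinearMap.id ℝ (Fin 4 → ℝ))
      (closedBall approxSolution (1 / 5000)) (1 / 4) := by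
  intro x hx y hy
  set d := ‖x - y‖ with hd
  have hd0 : 0 ≤ d := norm_nonneg _
  have hsub : ∀ i, |x i - y i| ≤ d := fun i => by
    simpa using norm_le_pi_norm (x - y) i
  have base : ∀ i, AffineApprox d (x i) (y i) (approxSolution i) (1 / 5000) (x i - y i) 1 0 := by
    intro i
    rw [mem_closedBall, dist_eq_norm] at hx hy
    refine ⟨?_, ?_, by simpa using hsub i, by simp⟩
    · simpa using (norm_le_pi_norm (x - approxSolution) i).trans hx
    · simpa using (norm_le_pi_norm (y - approxSolution) i).trans hy
  have f1 := abs_le.1 (abs_g1_sub_sub_le base)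
  have f2 := abs_le.1 (abs_g2_sub_sub_le base)
  have f3 := abs_le.1 (abs_g3_sub_sub_le base)
  have f4 := abs_le.1 (abs_g4_sub_sub_le base)
  have b0 := abs_le.1 (hsub 0)
  have b1 := abs_le.1 (hsub 1)
  have b2 := abs_le.1 (hsub 2)
  have b3 := abs_le.1 (hsub 3)
  refine (pi_norm_le_iff_of_nonneg (by positivity)).2 fun i => ?_
  rw [Real.norm_eq_abs, abs_le]
  fin_cases i <;> simp [preconditioned] <;> constructor <;> linarith

theorem norm_preconditioned_approxSolution_le :
    ‖preconditioned approxSolution‖ ≤ (1 - ((1 / 4 : NNReal) : ℝ)) * (1 / 5000) := by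
  refine (pi_norm_le_iff_of_nonneg (by norm_num)).2 fun i => ?_
  rw [Real.norm_eq_abs, abs_le]
  fin_cases i <;>
    norm_num [preconditioned, approxSolution_zero, approxSolution_one, approxSolution_two,
      approxSolution_three, g1, g2, g3, g4]

/-- The system `g1 = g2 = g3 = g4 = 0` has a solution with `0.45 < x1 < 0.46`,
`0.12 < x2 < 0.13`, `1.02 < x12 < 1.04` and `0.34 < x13 < 0.36`; in particular a second positive
solution with `x13 ≠ 1`. -/
theorem stmt17 :
    ∃ x1 x2 x12 x13 : ℝ,
      0.45 < x1 ∧ x1 < 0.46 ∧ 0.12 < x2 ∧ x2 < 0.13 ∧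
      1.02 < x12 ∧ x12 < 1.04 ∧ 0.34 < x13 ∧ x13 < 0.36 ∧
      g1 x1 x2 x12 x13 = 0 ∧ g2 x1 x2 x12 x13 = 0 ∧
      g3 x1 x2 x12 x13 = 0 ∧ g4 x1 x2 x12 x13 = 0 := by
  obtain ⟨x, hx, h⟩ := exists_mem_closedBall_eq_zero_of_approximatesLinearOn_id (by norm_num)
    approximatesLinearOn_preconditioned norm_preconditioned_approxSolution_le
  have hball : ∀ i, |x i - approxSolution i| ≤ 1 / 5000 := fun i => by
    rw [Metric.mem_closedBall, dist_eq_norm] at hx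
    simpa using (norm_le_pi_norm (x - approxSolution) i).trans hx
  have b0 := abs_le.1 (hball 0)
  have b1 := abs_le.1 (hball 1)
  have b2 := abs_le.1 (hball 2)
  have b3 := abs_le.1 (hball 3)
  have z0 := congrFun h 0
  have z1 := congrFun h 1
  have z2 := congrFun h 2
  have z3 := congrFun h 3
  rw [approxSolution_zero] at b0
  rw [approxSolution_one] at b1
  rw [approxSolution_two] at b2
  rw [approxSolution_three] at b3
  simp [preconditioned] at z0 z1 z2 z3
  refine ⟨x 0, x 1, x 2, x 3, ?_, ?_, ?_, ?_, ?_, ?_, ?_, ?_, ?_, ?_, ?_, ?_⟩ <;> linarith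
end
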